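/- (Global error estimate for the variable-coefficient Poisson equation.) There exists a constant C > 0, depending only on d, σ and sup_{R∈[0,1]}|Ŵ'(R)|, with the following property. Let d ∈ {1,2,3}, Ω = [0,l]^d, 0 < h ≤ 1, and adopt the particle setting with a radial smoothing kernel satisfying the decay condition, with a_i = a(x_i) where a ∈ C³(Ω) satisfies a(x) ≥ a_min > 0 on Ω, and assume the system is connected to the boundary. Let u ∈ C⁴(Ω) satisfy ∇·(a∇u)(x) = f(x) for all x ∈ Ω and u = 0 on ∂Ω. Assume, for every interior index i, the regularity condition: for every multi-index α with 0 ≤ |α| ≤ 2 and every unit multi-index β, |∑_{j≠i} V_{i,j}(x_j − x_i)^α (∇W(x_i − x_j))^β − γ̄_{α,β}| ≤ h², where γ̄_{α,β} = 1 if α = β and 0 otherwise. Set λ = (‖a‖_{C¹(Ω)}+2)/a_min and g(x) = e^{λx₁}, and assume C·h²·‖a‖_{C³(Ω)}·‖g‖_{C⁴(Ω)} ≤ 1. If U = (U_1,…,U_N) satisfies ℒ_h U_i = f(x_i) for every interior index i and U_i = 0 for every boundary index i, then max_{1≤i≤N} |U_i − u(x_i)| ≤ C·h²·e^{λ l}·‖a‖_{C³(Ω)}·‖u‖_{C⁴(Ω)}.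 -/

import Mathlib

open scoped BigOperators RealInnerProductSpace
open Finset MeasureTheory

noncomputable section

/-- `ℝ^d` as Euclidean space. -/
abbrev Ed (d : ℕ) : Type := EuclideanSpace ℝ (Fin d)

/-- Value of the radial smoothing kernel `W(x) = (σ/h^d)·Ŵ(‖x‖/h)`,
with profile `P = Ŵ`. -/
def Wval (d : ℕ) (σ h : ℝ) (P : ℝ → ℝ) (x : Ed d) : ℝ :=
  (σ / h ^ d) * P (‖x‖ / h)

/-- Gradient of the radial smoothing kernel:
`∇W(x) = (σ/h^{d+1})·Ŵ'(‖x‖/h)·x/‖x‖` for `x ≠ 0`. -/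
def gradW (d : ℕ) (σ h : ℝ) (P : ℝ → ℝ) (x : Ed d) : Ed d :=
  ((σ / h ^ (d + 1)) * deriv P (‖x‖ / h) / ‖x‖) • x

/-- Multi-index power `v^α = v_1^{α_1}⋯v_d^{α_d}`. -/
def mpow {d : ℕ} (v : Ed d) (α : Fin d → ℕ) : ℝ := ∏ k, (v k) ^ (α k)

/-- Total degree `|α| = α_1 + ⋯ + α_d` of a multi-index. -/
def deg {d : ℕ} (α : Fin d → ℕ) : ℕ := ∑ k, α k

/-- Partial derivative along the `k`-th coordinate. -/
def pd {d : ℕ} (k : Fin d) (f : Ed d → ℝ) : Ed d → ℝ :=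
  fun x => fderiv ℝ f x (EuclideanSpace.single k 1)

/-- Mixed partial derivative `D^α f`. -/
def Dmix {d : ℕ} (α : Fin d → ℕ) (f : Ed d → ℝ) : Ed d → ℝ :=
  (List.finRange d).foldr (fun k g => (pd k)^[α k] g) f

/-- Laplacian `Δf = ∑_k ∂_k∂_k f`. -/
def lapl {d : ℕ} (f : Ed d → ℝ) : Ed d → ℝ := fun x => ∑ k, pd k (pd k f) x

/-- Variable coefficient elliptic operator `∇·(a∇f) = aΔf + ∇a·∇f`. -/
def ellip {d : ℕ} (a f : Ed d → ℝ) : Ed d → ℝ :=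
  fun x => a x * lapl f x + ∑ k, pd k a x * pd k f x

/-- The closed cube `Ω = [0,l]^d`. -/
def cube (d : ℕ) (l : ℝ) : Set (Ed d) := {x | ∀ k, x k ∈ Set.Icc 0 l}

/-- The `C^n(Ω)` norm: the max over multi-indices `α` with `|α| ≤ n` of
`sup_{x ∈ Ω} |D^α f x|`. -/
def Cnorm {d : ℕ} (n : ℕ) (f : Ed d → ℝ) (Ω : Set (Ed d)) : ℝ :=
  sSup {y : ℝ | ∃ α : Fin d → ℕ, deg α ≤ n ∧ ∃ x ∈ Ω, y = |Dmix α f x|}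

/-- Coefficient `c_{i,j} = −V_{i,j}(a_i+a_j)((x_i−x_j)·∇W(x_i−x_j))/‖x_i−x_j‖²`. -/
def cSPH (d N : ℕ) (σ h : ℝ) (P : ℝ → ℝ) (x : Fin N → Ed d)
    (a : Fin N → ℝ) (V : Fin N → Fin N → ℝ) (i j : Fin N) : ℝ :=
  -(V i j * ((a i + a j) *
      (⟪x i - x j, gradW d σ h P (x i - x j)⟫ / ‖x i - x j‖ ^ 2)))

/-- Discrete operator `ℒ_h U i = ∑_{j ≠ i} c_{i,j}(U_j − U_i)`. -/
def Lh (d N : ℕ) (σ h : ℝ) (P : ℝ → ℝ) (x : Fin N → Ed d)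
    (a : Fin N → ℝ) (V : Fin N → Fin N → ℝ) (U : Fin N → ℝ) (i : Fin N) : ℝ :=
  ∑ j ∈ Finset.univ.erase i, cSPH d N σ h P x a V i j * (U j - U i)

/-- The particle system is connected to the boundary: from every interior
index there is a chain of positive coefficients, through interior indices,
reaching a boundary index. -/
def ConnBd (Nin : ℕ) {N : ℕ} (c : Fin N → Fin N → ℝ) : Prop :=
  ∀ i : Fin N, (i : ℕ) < Nin →
    ∃ (m : ℕ) (p : Fin (m + 1) → Fin N),
      p 0 = i ∧ Nin ≤ (p (Fin.last m) : ℕ) ∧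
      (∀ k : Fin m, (p k.castSucc : ℕ) < Nin) ∧
      (∀ k : Fin m, 0 < c (p k.castSucc) (p k.succ))

lemma pd_contDiff {d n : ℕ} (k : Fin d) {f : Ed d → ℝ} (hf : ContDiff ℝ (n + 1 : ℕ) f) :
    ContDiff ℝ (n : ℕ) (pd k f) := by
  have h1 : ContDiff ℝ (n : ℕ) (fderiv ℝ f) := hf.fderiv_right (by push_cast; exact le_rfl)
  exact h1.clm_apply contDiff_const

lemma pd_comm {d : ℕ} (k l : Fin d) {f : Ed d → ℝ} (hf : ContDiff ℝ (2 : ℕ) f) :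
    pd k (pd l f) = pd l (pd k f) := by
  funext x
  have h1 : ContDiff ℝ (1 : ℕ) (fderiv ℝ f) := hf.fderiv_right (by norm_num)
  have hdiff : DifferentiableAt ℝ (fderiv ℝ f) x := (h1.differentiable (by norm_num)) x
  have key : ∀ v w : Ed d, fderiv ℝ (fun y => fderiv ℝ f y v) x w
      = fderiv ℝ (fderiv ℝ f) x w v := by
    intro v w
    rw [fderiv_clm_apply hdiff (differentiableAt_const v)]
    simp
  have hs : IsSymmSndFDerivAt ℝ f x := by
    apply (hf.contDiffAt).isSymmSndFDerivAt
    simp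
  unfold pd
  rw [key, key]
  exact hs _ _

/-- Iterated partial derivatives along a list of coordinates. -/
def pdl {d : ℕ} (L : List (Fin d)) (f : Ed d → ℝ) : Ed d → ℝ := L.foldr pd f

lemma pdl_contDiff {d : ℕ} (L : List (Fin d)) {f : Ed d → ℝ} :
    ∀ m : ℕ, ContDiff ℝ (m + L.length : ℕ) f → ContDiff ℝ (m : ℕ) (pdl L f) := by
  induction L with
  | nil => intro m hf; simpa [pdl] using hf
  | cons k L ih =>
    intro m hf
    have : ContDiff ℝ (m + 1 : ℕ) (pdl L f) := by
      apply ih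
      have e : m + (k :: L).length = m + 1 + L.length := by simp; ring
      rw [e] at hf; exact hf
    exact pd_contDiff k this

lemma pdl_perm {d : ℕ} {L L' : List (Fin d)} (hL : L.Perm L') {f : Ed d → ℝ} :
    ContDiff ℝ (L.length : ℕ) f → pdl L f = pdl L' f := by
  induction hL with
  | nil => intro _; rfl
  | cons k h ih =>
    intro hf
    have := ih (hf.of_le (by simp))
    show pd k (pdl _ f) = pd k (pdl _ f)
    rw [this]
  | swap k l L =>
    intro hf
    show pd l (pd k (pdl L f)) = pd k (pd l (pdl L f))
    apply pd_comm
    apply pdl_contDiff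
    have e : (l :: k :: L).length = 2 + L.length := by simp; ring
    rw [e] at hf; exact hf
  | trans h1 h2 ih1 ih2 =>
    intro hf
    rw [ih1 hf]
    apply ih2
    rw [← h1.length_eq]; exact hf

/-- Sorted list of a multi-index. -/
def mlist {d : ℕ} (α : Fin d → ℕ) (S : List (Fin d)) : List (Fin d) :=
  S.flatMap (fun k => List.replicate (α k) k)

lemma pdl_append {d : ℕ} (L L' : List (Fin d)) (f : Ed d → ℝ) :
    pdl (L ++ L') f = pdl L (pdl L' f) := by
  simp [pdl, List.foldr_append]

lemma pdl_replicate {d : ℕ} (k : Fin d) (n : ℕ) (f : Ed d → ℝ) :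
    pdl (List.replicate n k) f = (pd k)^[n] f := by
  induction n with
  | zero => rfl
  | succ n ih =>
    rw [Function.iterate_succ_apply', ← ih]; rfl

lemma foldr_eq_pdl {d : ℕ} (α : Fin d → ℕ) (S : List (Fin d)) (f : Ed d → ℝ) :
    S.foldr (fun k g => (pd k)^[α k] g) f = pdl (mlist α S) f := by
  induction S with
  | nil => rfl
  | cons k S ih =>
    have : mlist α (k :: S) = List.replicate (α k) k ++ mlist α S := by simp [mlist]
    rw [this, pdl_append, ← ih, pdl_replicate]
    rfl

lemma mlist_length {d : ℕ} (α : Fin d → ℕ) : (mlist α (List.finRange d)).length = deg α := by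
  unfold mlist deg
  rw [List.length_flatMap]
  simp only [List.length_replicate]
  rw [← List.ofFn_eq_map, List.sum_ofFn]

lemma mlist_count {d : ℕ} (L : List (Fin d)) :
    L.Perm (mlist (fun k => L.count k) (List.finRange d)) := by
  rw [List.perm_iff_count]
  intro k
  unfold mlist
  rw [List.count_flatMap]
  have : (List.count k ∘ fun j => List.replicate (L.count j) j)
      = fun j => if j = k then L.count k else 0 := by
    funext j
    simp only [Function.comp, List.count_replicate]
    by_cases h : j = k <;> simp [h]
  rw [this, ← List.ofFn_eq_map, List.sum_ofFn]
  simp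

lemma pdl_eq_Dmix {d : ℕ} (L : List (Fin d)) {f : Ed d → ℝ}
    (hf : ContDiff ℝ (L.length : ℕ) f) :
    ∃ α : Fin d → ℕ, deg α = L.length ∧ Dmix α f = pdl L f := by
  refine ⟨fun k => L.count k, ?_, ?_⟩
  · rw [← mlist_length]; exact (mlist_count L).length_eq.symm
  · unfold Dmix
    rw [foldr_eq_pdl, pdl_perm (mlist_count L) hf]

lemma cube_compact (d : ℕ) (l : ℝ) : IsCompact (cube d l) := by
  have h : cube d l = (EuclideanSpace.equiv (Fin d) ℝ).toHomeomorph ⁻¹'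
      (Set.pi Set.univ (fun _ => Set.Icc (0 : ℝ) l)) := by
    ext x
    simp only [cube, Set.mem_ofPred_eq, Set.mem_preimage, Set.mem_pi, Set.mem_univ, true_imp_iff]
    rfl
  rw [h, Homeomorph.isCompact_preimage]
  exact isCompact_univ_pi (fun _ => isCompact_Icc)

lemma cube_seg {d : ℕ} {l : ℝ} {p q : Ed d} (hp : p ∈ cube d l) (hq : q ∈ cube d l)
    {s : ℝ} (h0 : 0 ≤ s) (h1 : s ≤ 1) : p + s • (q - p) ∈ cube d l := by
  intro k
  have a := hp k
  have b := hq k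
  simp only [PiLp.add_apply, PiLp.smul_apply, PiLp.sub_apply, smul_eq_mul, Set.mem_Icc] at *
  constructor <;> nlinarith

lemma Cnorm_bdd {d n : ℕ} {l : ℝ} {f : Ed d → ℝ} (hf : ContDiff ℝ (n : ℕ) f) :
    BddAbove {y : ℝ | ∃ α : Fin d → ℕ, deg α ≤ n ∧ ∃ x ∈ cube d l, y = |Dmix α f x|} := by
  have hfin : Set.Finite {α : Fin d → ℕ | deg α ≤ n} := by
    apply (Set.finite_Iic (fun _ : Fin d => n)).subset
    intro α hα k
    exact (Finset.single_le_sum (f := α) (fun _ _ => Nat.zero_le _) (Finset.mem_univ k)).trans hα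
  have : {y : ℝ | ∃ α : Fin d → ℕ, deg α ≤ n ∧ ∃ x ∈ cube d l, y = |Dmix α f x|}
      = ⋃ α ∈ {α : Fin d → ℕ | deg α ≤ n}, (fun x => |Dmix α f x|) '' cube d l := by
    ext y
    simp only [Set.mem_ofPred_eq, Set.mem_iUnion, Set.mem_image, exists_prop, eq_comm]
  rw [this, hfin.bddAbove_biUnion]
  intro α hα
  apply IsCompact.bddAbove
  apply (cube_compact d l).image
  have hc : ContDiff ℝ (0 : ℕ) (Dmix α f) := by
    unfold Dmix
    rw [foldr_eq_pdl]
    apply pdl_contDiff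
    rw [mlist_length]
    exact hf.of_le (by exact_mod_cast (by simpa using hα))
  exact hc.continuous.abs

lemma pdl_le_Cnorm {d n : ℕ} {l : ℝ} {f : Ed d → ℝ} (hf : ContDiff ℝ (n : ℕ) f)
    (L : List (Fin d)) (hL : L.length ≤ n) {x : Ed d} (hx : x ∈ cube d l) :
    |pdl L f x| ≤ Cnorm n f (cube d l) := by
  obtain ⟨α, h1, h2⟩ := pdl_eq_Dmix L (hf.of_le (by exact_mod_cast hL))
  exact le_csSup (Cnorm_bdd hf) ⟨α, h1 ▸ hL, x, hx, by rw [h2]⟩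

lemma max_principle {N Nin : ℕ} {c : Fin N → Fin N → ℝ}
    (hc : ∀ i j : Fin N, (i : ℕ) < Nin → j ≠ i → 0 ≤ c i j)
    (hconn : ConnBd Nin c) (e : Fin N → ℝ)
    (he : ∀ i : Fin N, (i : ℕ) < Nin → 0 ≤ ∑ j ∈ Finset.univ.erase i, c i j * (e j - e i))
    (hb : ∀ i : Fin N, Nin ≤ (i : ℕ) → e i ≤ 0) : ∀ i, e i ≤ 0 := by
  intro i0
  have : Nonempty (Fin N) := ⟨i0⟩
  obtain ⟨i, hi⟩ := Finite.exists_max e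
  by_contra hneg
  have hpos : 0 < e i := lt_of_lt_of_le (not_le.mp hneg) (hi i0)
  have hin : (i : ℕ) < Nin := by
    by_contra hh
    exact absurd (hb i (not_lt.mp hh)) (not_le.mpr hpos)
  obtain ⟨m, p, hp0, hpl, hpin, hpc⟩ := hconn i hin
  have hall : ∀ k : Fin (m + 1), e (p k) = e i := by
    intro k
    induction k using Fin.induction with
    | zero => rw [hp0]
    | succ k ih =>
      by_cases hEq : p k.succ = p k.castSucc
      · rw [hEq, ih]
      · have hsum := he _ (hpin k)
        have hnp : ∀ j ∈ Finset.univ.erase (p k.castSucc),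
            c (p k.castSucc) j * (e j - e (p k.castSucc)) ≤ 0 := by
          intro j hj
          apply mul_nonpos_of_nonneg_of_nonpos
          · exact hc _ _ (hpin k) (Finset.ne_of_mem_erase hj)
          · rw [ih]; linarith [hi j]
        have hz : ∑ j ∈ Finset.univ.erase (p k.castSucc),
            c (p k.castSucc) j * (e j - e (p k.castSucc)) = 0 :=
          le_antisymm (Finset.sum_nonpos hnp) hsum
        have := (Finset.sum_eq_zero_iff_of_nonpos hnp).mp hz (p k.succ) (by simp [hEq])
        rcases mul_eq_zero.mp this with h | h
        · exact absurd h (hpc k).ne'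
        · linarith
  have := hb _ hpl
  rw [hall] at this
  linarith

/-- Directional derivative. -/
def Dr {d : ℕ} (r : Ed d) (f : Ed d → ℝ) : Ed d → ℝ := fun x => ∑ k, r k * pd k f x

lemma Dr_eq {d : ℕ} (r : Ed d) (f : Ed d → ℝ) (x : Ed d) : Dr r f x = fderiv ℝ f x r := by
  unfold Dr pd
  have : r = ∑ k, r k • EuclideanSpace.single k (1 : ℝ) := by
    ext j
    simp [Finset.sum_apply, Pi.single_apply]
  conv_rhs => rw [this]
  simp [map_sum]

lemma Dr_contDiff {d n : ℕ} (r : Ed d) {f : Ed d → ℝ} (hf : ContDiff ℝ (n + 1 : ℕ) f) :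
    ContDiff ℝ (n : ℕ) (Dr r f) := by
  unfold Dr
  exact ContDiff.sum (fun k _ => contDiff_const.mul (pd_contDiff k hf))

lemma Dr_sum {d : ℕ} {ι : Type*} (s : Finset ι) (r : Ed d) (q : ι → ℝ) (f : ι → Ed d → ℝ)
    (hf : ∀ k, Differentiable ℝ (f k)) :
    Dr r (fun x => ∑ k ∈ s, q k * f k x) = fun x => ∑ k ∈ s, q k * Dr r (f k) x := by
  funext x
  simp only [Dr_eq]
  have : HasFDerivAt (fun x => ∑ k ∈ s, q k * f k x) (∑ k ∈ s, q k • fderiv ℝ (f k) x) x := by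
    apply HasFDerivAt.fun_sum
    intro k _
    exact ((hf k) x).hasFDerivAt.const_mul (q k)
  rw [this.fderiv]
  simp

lemma taylor_Dr {d : ℕ} (p r : Ed d) (M : ℝ) (n : ℕ) : ∀ f : Ed d → ℝ, ContDiff ℝ (n : ℕ) f →
    (∀ s ∈ Set.Icc (0:ℝ) 1, |(Dr r)^[n] f (p + s • r)| ≤ M) →
    ∀ s ∈ Set.Icc (0:ℝ) 1, |f (p + s • r) -
      ∑ m ∈ Finset.range n, s ^ m / (m.factorial : ℝ) * (Dr r)^[m] f p| ≤ M := by
  induction n with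
  | zero => intro f _ hb s hs; simpa using hb s hs
  | succ n ih =>
    intro f hf hb s hs
    have ih' := ih (Dr r f) (Dr_contDiff r hf) (by simpa [Function.iterate_succ_apply] using hb)
    have hM : 0 ≤ M := (abs_nonneg _).trans (ih' s hs)
    set G : ℝ → ℝ := fun s => f (p + s • r) -
      ∑ m ∈ Finset.range (n + 1), s ^ m / (m.factorial : ℝ) * (Dr r)^[m] f p with hG
    have hG0 : G 0 = 0 := by
      simp [hG, Finset.sum_range_succ']
    have hder : ∀ t ∈ Set.Icc (0:ℝ) 1, HasDerivWithinAt G (Dr r f (p + t • r) -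
      ∑ m ∈ Finset.range n, t ^ m / (m.factorial : ℝ) * (Dr r)^[m] (Dr r f) p)
        (Set.Icc 0 1) t := by
      intro t _
      apply HasDerivAt.hasDerivWithinAt
      have h1 : HasDerivAt (fun t : ℝ => f (p + t • r)) (Dr r f (p + t • r)) t := by
        rw [Dr_eq]
        have hfd : HasFDerivAt f (fderiv ℝ f (p + t • r)) (p + t • r) :=
          ((hf.differentiable (by simp)) _).hasFDerivAt
        have hl : HasDerivAt (fun t : ℝ => p + t • r) r t := by
          simpa using ((hasDerivAt_id t).smul_const r).const_add p
        exact hfd.comp_hasDerivAt t hl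
      apply h1.sub
      have h2 : HasDerivAt (fun t : ℝ => ∑ m ∈ Finset.range n,
          t ^ (m+1) / ((m+1).factorial : ℝ) * (Dr r)^[m+1] f p + f p)
          (∑ m ∈ Finset.range n, t ^ m / (m.factorial : ℝ) * (Dr r)^[m] (Dr r f) p) t := by
        apply HasDerivAt.add_const
        apply HasDerivAt.fun_sum
        intro m _
        have h3 := ((hasDerivAt_pow (m+1) t).div_const ((m+1).factorial : ℝ)).mul_const
          ((Dr r)^[m+1] f p)
        have he : t ^ m / (m.factorial : ℝ) * (Dr r)^[m] (Dr r f) p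
            = ((m + 1 : ℕ) : ℝ) * t ^ (m + 1 - 1) / ((m + 1).factorial : ℝ)
              * (Dr r)^[m+1] f p := by
          rw [Function.iterate_succ_apply, Nat.factorial_succ]
          push_cast
          have : (m.factorial : ℝ) ≠ 0 := by positivity
          have : (m : ℝ) + 1 ≠ 0 := by positivity
          field_simp
          try simp
        rw [he]
        exact h3
      have he : (fun s : ℝ => ∑ m ∈ Finset.range (n + 1),
          s ^ m / (m.factorial : ℝ) * (Dr r)^[m] f p)
          = (fun t : ℝ => ∑ m ∈ Finset.range n,
          t ^ (m+1) / ((m+1).factorial : ℝ) * (Dr r)^[m+1] f p + f p) := by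
        funext t
        rw [Finset.sum_range_succ']
        simp
      rw [he]
      exact h2
    have hmv := (convex_Icc (0:ℝ) 1).norm_image_sub_le_of_norm_hasDerivWithin_le hder
      (C := M) (fun t ht => by simpa using ih' t ht) (Set.left_mem_Icc.mpr zero_le_one) hs
    rw [hG0] at hmv
    simp only [sub_zero, Real.norm_eq_abs, abs_of_nonneg hs.1] at hmv
    exact hmv.trans (mul_le_of_le_one_right hM hs.2)

lemma Dr_iter_contDiff {d n : ℕ} (r : Ed d) (m : ℕ) : ∀ {f : Ed d → ℝ},
    ContDiff ℝ (n + m : ℕ) f → ContDiff ℝ (n : ℕ) ((Dr r)^[m] f) := by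
  induction m with
  | zero => intro f hf; simpa using hf
  | succ m ih => intro f hf; exact ih (Dr_contDiff r hf)

lemma Dr_iter_sum {d : ℕ} {ι : Type*} (s : Finset ι) (r : Ed d) (q : ι → ℝ) (n : ℕ)
    (f : ι → Ed d → ℝ) (hf : ∀ k, ContDiff ℝ (n : ℕ) (f k)) :
    (Dr r)^[n] (fun x => ∑ k ∈ s, q k * f k x) = fun x => ∑ k ∈ s, q k * (Dr r)^[n] (f k) x := by
  induction n with
  | zero => rfl
  | succ n ih =>
    simp only [Function.iterate_succ_apply']
    rw [ih (fun k => (hf k).of_le (by simp)), Dr_sum]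
    intro k
    have h1 : ContDiff ℝ (1 : ℕ) ((Dr r)^[n] (f k)) := by
      apply Dr_iter_contDiff
      rw [add_comm]; exact hf k
    exact h1.differentiable (by norm_num)

lemma Dr_iter_succ {d n : ℕ} (r : Ed d) {f : Ed d → ℝ} (hf : ContDiff ℝ (n + 1 : ℕ) f)
    (x : Ed d) : (Dr r)^[n + 1] f x = ∑ k, r k * (Dr r)^[n] (pd k f) x := by
  rw [Function.iterate_succ_apply]
  have := Dr_iter_sum Finset.univ r (fun k => r k) n (fun k => pd k f)
    (fun k => pd_contDiff k hf)
  exact congrFun this x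

lemma Dr_iter_bound {d : ℕ} (r x : Ed d) (M : ℝ) (n : ℕ) : ∀ f : Ed d → ℝ,
    ContDiff ℝ (n : ℕ) f → (∀ L : List (Fin d), L.length = n → |pdl L f x| ≤ M) →
    |(Dr r)^[n] f x| ≤ (∑ k, |r k|) ^ n * M := by
  induction n with
  | zero => intro f _ h; simpa [pdl] using h [] rfl
  | succ n ih =>
    intro f hf h
    rw [Dr_iter_succ r hf]
    refine (Finset.abs_sum_le_sum_abs _ _).trans ?_
    rw [pow_succ', Finset.sum_mul, Finset.sum_mul]
    apply Finset.sum_le_sum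
    intro k _
    rw [abs_mul, mul_assoc]
    apply mul_le_mul_of_nonneg_left _ (abs_nonneg _)
    apply ih _ (pd_contDiff k hf)
    intro L hL
    have := h (L ++ [k]) (by simp [hL])
    rw [pdl_append] at this
    exact this

lemma taylor3 {d : ℕ} {l : ℝ} {p q : Ed d} (hp : p ∈ cube d l) (hq : q ∈ cube d l)
    {f : Ed d → ℝ} (hf : ContDiff ℝ (3 : ℕ) f) :
    |f q - (f p + ∑ k, pd k f p * (q - p) k
      + 1 / 2 * ∑ kl : Fin d × Fin d, pdl [kl.2, kl.1] f p * ((q - p) kl.1 * (q - p) kl.2))|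
      ≤ (∑ k, |(q - p) k|) ^ 3 * Cnorm 3 f (cube d l) := by
  have h := taylor_Dr p (q - p) ((∑ k, |(q - p) k|) ^ 3 * Cnorm 3 f (cube d l)) 3 f hf
    (fun s hs => Dr_iter_bound _ _ _ 3 f hf
      (fun L hL => pdl_le_Cnorm hf L hL.le (cube_seg hp hq hs.1 hs.2))) 1 (by simp)
  refine le_of_eq_of_le ?_ h
  congr 1
  have h2 : (Dr (q - p))^[2] f p = ∑ kl : Fin d × Fin d,
      pdl [kl.2, kl.1] f p * ((q - p) kl.1 * (q - p) kl.2) := by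
    rw [Dr_iter_succ _ (hf.of_le (by norm_num)), Fintype.sum_prod_type]
    apply Finset.sum_congr rfl; intro k _
    rw [Function.iterate_one, Dr, Finset.mul_sum]
    apply Finset.sum_congr rfl; intro m _
    simp only [pdl, List.foldr]; ring
  have h1 : (Dr (q - p))^[1] f p = ∑ k, pd k f p * (q - p) k := by
    rw [Function.iterate_one, Dr]
    apply Finset.sum_congr rfl; intro m _; ring
  rw [Finset.sum_range_succ, Finset.sum_range_succ, Finset.sum_range_succ, h1, h2]
  simp [Nat.factorial]

lemma taylor4 {d : ℕ} {l : ℝ} {p q : Ed d} (hp : p ∈ cube d l) (hq : q ∈ cube d l)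
    {f : Ed d → ℝ} (hf : ContDiff ℝ (4 : ℕ) f) :
    |f q - f p - (∑ k, pd k f p * (q - p) k
      + 1 / 2 * ∑ kl : Fin d × Fin d, pdl [kl.2, kl.1] f p * ((q - p) kl.1 * (q - p) kl.2)
      + 1 / 6 * ∑ z : Fin d × Fin d × Fin d, pdl [z.2.2, z.2.1, z.1] f p
        * ((q - p) z.1 * ((q - p) z.2.1 * (q - p) z.2.2)))|
      ≤ (∑ k, |(q - p) k|) ^ 4 * Cnorm 4 f (cube d l) := by
  have h := taylor_Dr p (q - p) ((∑ k, |(q - p) k|) ^ 4 * Cnorm 4 f (cube d l)) 4 f hf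
    (fun s hs => Dr_iter_bound _ _ _ 4 f hf
      (fun L hL => pdl_le_Cnorm hf L hL.le (cube_seg hp hq hs.1 hs.2))) 1 (by simp)
  refine le_of_eq_of_le ?_ h
  congr 1
  have h3 : (Dr (q - p))^[3] f p = ∑ z : Fin d × Fin d × Fin d, pdl [z.2.2, z.2.1, z.1] f p
        * ((q - p) z.1 * ((q - p) z.2.1 * (q - p) z.2.2)) := by
    rw [Dr_iter_succ _ (hf.of_le (by norm_num)), Fintype.sum_prod_type]
    apply Finset.sum_congr rfl; intro k _
    rw [Dr_iter_succ _ (pd_contDiff k (hf.of_le (by norm_num))), Fintype.sum_prod_type,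
      Finset.mul_sum]
    apply Finset.sum_congr rfl; intro m _
    rw [Function.iterate_one, Dr, Finset.mul_sum, Finset.mul_sum]
    apply Finset.sum_congr rfl; intro m _
    simp only [pdl, List.foldr]; ring
  have h2 : (Dr (q - p))^[2] f p = ∑ kl : Fin d × Fin d,
      pdl [kl.2, kl.1] f p * ((q - p) kl.1 * (q - p) kl.2) := by
    rw [Dr_iter_succ _ (hf.of_le (by norm_num)), Fintype.sum_prod_type]
    apply Finset.sum_congr rfl; intro k _
    rw [Function.iterate_one, Dr, Finset.mul_sum]
    apply Finset.sum_congr rfl; intro m _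
    simp only [pdl, List.foldr]; ring
  have h1 : (Dr (q - p))^[1] f p = ∑ k, pd k f p * (q - p) k := by
    rw [Function.iterate_one, Dr]
    apply Finset.sum_congr rfl; intro m _; ring
  rw [Finset.sum_range_succ, Finset.sum_range_succ, Finset.sum_range_succ,
    Finset.sum_range_succ, h1, h2, h3]
  simp [Nat.factorial]
  ring

lemma moment {ι κ : Type*} [Fintype κ] (J : Finset ι) (v : ι → ℝ) (y : ι → κ → ℝ) (μ q : κ → ℝ)
    {ε Q : ℝ} (hQ : ∀ z, |q z| ≤ Q) (hm : ∀ z, |∑ j ∈ J, v j * y j z - μ z| ≤ ε) :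
    |∑ j ∈ J, v j * ∑ z, q z * y j z - ∑ z, q z * μ z| ≤ Fintype.card κ * (Q * ε) := by
  have : ∑ j ∈ J, v j * ∑ z, q z * y j z - ∑ z, q z * μ z
      = ∑ z, q z * (∑ j ∈ J, v j * y j z - μ z) := by
    simp only [mul_sub, Finset.sum_sub_distrib, Finset.mul_sum]
    rw [Finset.sum_comm]
    congr 1
    apply Finset.sum_congr rfl; intro z _
    apply Finset.sum_congr rfl; intro j _
    ring
  rw [this]
  refine (Finset.abs_sum_le_sum_abs _ _).trans ?_
  have : ∀ z ∈ (Finset.univ : Finset κ), |q z * (∑ j ∈ J, v j * y j z - μ z)| ≤ Q * ε := by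
    intro z _
    rw [abs_mul]
    exact mul_le_mul (hQ z) (hm z) (abs_nonneg _) ((abs_nonneg _).trans (hQ z))
  refine (Finset.sum_le_card_nsmul _ _ _ this).trans ?_
  simp

lemma form_bound {κ : Type*} [Fintype κ] (q y : κ → ℝ) {Q : ℝ} (hQ : ∀ z, |q z| ≤ Q) :
    |∑ z, q z * y z| ≤ (∑ z, |y z|) * Q := by
  refine (Finset.abs_sum_le_sum_abs _ _).trans ?_
  rw [Finset.sum_mul]
  apply Finset.sum_le_sum; intro z _
  rw [abs_mul, mul_comm]
  exact mul_le_mul_of_nonneg_left (hQ z) (abs_nonneg _)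

lemma abs_sum2 {d : ℕ} (r : Fin d → ℝ) :
    ∑ z : Fin d × Fin d, |r z.1 * r z.2| = (∑ k, |r k|) ^ 2 := by
  rw [Fintype.sum_prod_type, sq, Finset.sum_mul_sum]
  simp only [abs_mul]

lemma abs_sum3 {d : ℕ} (r : Fin d → ℝ) :
    ∑ z : Fin d × Fin d × Fin d, |r z.1 * (r z.2.1 * r z.2.2)| = (∑ k, |r k|) ^ 3 := by
  rw [Fintype.sum_prod_type, pow_succ', ← abs_sum2, Finset.sum_mul_sum]
  simp only [abs_mul]

lemma scalar_err {A B a0 aj fj α1 α2 φ1 φ2 φ3 s D : ℝ} (hs : 0 ≤ s) (hD : s ≤ D) (hD1 : 1 ≤ D)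
    (ha0 : |a0| ≤ A)
    (h1 : |α1| ≤ s * A) (h2 : |α2| ≤ s ^ 2 * A)
    (g1 : |φ1| ≤ s * B) (g2 : |φ2| ≤ s ^ 2 * B) (g3 : |φ3| ≤ s ^ 3 * B) (hB : 0 ≤ B)
    (ha : |aj - (a0 + α1 + 1 / 2 * α2)| ≤ s ^ 3 * A)
    (hf : |fj - (φ1 + 1 / 2 * φ2 + 1 / 6 * φ3)| ≤ s ^ 4 * B) :
    |(a0 + aj) * fj - 2 * a0 * φ1 - (a0 * φ2 + α1 * φ1)
      - (1 / 3 * a0 * φ3 + 1 / 2 * (α1 * φ2) + 1 / 2 * (α2 * φ1))| ≤ s ^ 4 * (11 * D ^ 3 * A * B) := by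
  have hA : 0 ≤ A := (abs_nonneg _).trans ha0
  set Ra := aj - (a0 + α1 + 1 / 2 * α2) with hRa
  set Rf := fj - (φ1 + 1 / 2 * φ2 + 1 / 6 * φ3) with hRf
  have e : (a0 + aj) * fj - 2 * a0 * φ1 - (a0 * φ2 + α1 * φ1)
      - (1 / 3 * a0 * φ3 + 1 / 2 * (α1 * φ2) + 1 / 2 * (α2 * φ1))
      = 2 * a0 * Rf + α1 * (1 / 6 * φ3 + Rf) + 1 / 2 * α2 * (1 / 2 * φ2 + 1 / 6 * φ3 + Rf)
        + Ra * (φ1 + 1 / 2 * φ2 + 1 / 6 * φ3 + Rf) := by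
    rw [hRa, hRf]; ring
  rw [e]
  have k3 : |1 / 6 * φ3| ≤ s ^ 3 * B := by
    rw [abs_mul]; norm_num; linarith [abs_nonneg φ3]
  have k2 : |1 / 2 * φ2| ≤ s ^ 2 * B := by
    rw [abs_mul]; norm_num; linarith [abs_nonneg φ2]
  have j2 : |1 / 2 * α2| ≤ s ^ 2 * A := by
    rw [abs_mul]; norm_num; linarith [abs_nonneg α2]
  have j0 : |2 * a0| ≤ 2 * A := by
    rw [abs_mul]; norm_num; linarith
  have t1 : |2 * a0 * Rf| ≤ (2 * A) * (s ^ 4 * B) := by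
    rw [abs_mul]; exact mul_le_mul j0 hf (abs_nonneg _) (by positivity)
  have t2 : |α1 * (1 / 6 * φ3 + Rf)| ≤ (s * A) * (s ^ 3 * B + s ^ 4 * B) := by
    rw [abs_mul]
    exact mul_le_mul h1 ((abs_add_le _ _).trans (add_le_add k3 hf)) (abs_nonneg _) (by positivity)
  have t3 : |1 / 2 * α2 * (1 / 2 * φ2 + 1 / 6 * φ3 + Rf)|
      ≤ (s ^ 2 * A) * (s ^ 2 * B + s ^ 3 * B + s ^ 4 * B) := by
    rw [abs_mul]
    exact mul_le_mul j2 ((abs_add_le _ _).trans (add_le_add ((abs_add_le _ _).trans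
      (add_le_add k2 k3)) hf)) (abs_nonneg _) (by positivity)
  have t4 : |Ra * (φ1 + 1 / 2 * φ2 + 1 / 6 * φ3 + Rf)|
      ≤ (s ^ 3 * A) * (s * B + s ^ 2 * B + s ^ 3 * B + s ^ 4 * B) := by
    rw [abs_mul]
    exact mul_le_mul ha ((abs_add_le _ _).trans (add_le_add ((abs_add_le _ _).trans
      (add_le_add ((abs_add_le _ _).trans (add_le_add g1 k2)) k3)) hf)) (abs_nonneg _)
      (by positivity)
  have tot := (abs_add_le _ _).trans (add_le_add ((abs_add_le _ _).trans
    (add_le_add ((abs_add_le _ _).trans (add_le_add t1 t2)) t3)) t4)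
  refine tot.trans ?_
  have p1 : s ≤ D ^ 3 := hD.trans (le_self_pow₀ hD1 (by norm_num))
  have p2 : s ^ 2 ≤ D ^ 3 := (pow_le_pow_left₀ hs hD 2).trans (pow_le_pow_right₀ hD1 (by norm_num))
  have p3 : s ^ 3 ≤ D ^ 3 := pow_le_pow_left₀ hs hD 3
  have p0 : 1 ≤ D ^ 3 := one_le_pow₀ hD1
  have : 5 + 3 * s + 2 * s ^ 2 + s ^ 3 ≤ 11 * D ^ 3 := by linarith
  have hm := mul_le_mul_of_nonneg_left this (show 0 ≤ s ^ 4 * (A * B) by positivity)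
  nlinarith [hm]

lemma trunc {d : ℕ} (hd : 1 ≤ d) {ι : Type*} (J : Finset ι) (v : ι → ℝ) (r : ι → Fin d → ℝ)
    {h : ℝ} (h0 : 0 < h) (h1 : h ≤ 1) (hv : ∀ j ∈ J, 0 ≤ v j)
    (hsupp : ∀ j ∈ J, v j ≠ 0 → ∀ k, |r j k| ≤ h)
    (m1 : ∀ k, |∑ j ∈ J, v j * r j k| ≤ h ^ 2)
    (m2 : ∀ k l, |∑ j ∈ J, v j * (r j k * r j l) - if k = l then 1 else 0| ≤ h ^ 2)
    (m3 : ∀ k l m, |∑ j ∈ J, v j * (r j k * (r j l * r j m))| ≤ h ^ 2)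
    {A B a0 : ℝ} (a1 f1 : Fin d → ℝ) (a2 f2 : Fin d × Fin d → ℝ) (f3 : Fin d × Fin d × Fin d → ℝ)
    (ha0 : |a0| ≤ A) (ha1 : ∀ k, |a1 k| ≤ A) (ha2 : ∀ k, |a2 k| ≤ A)
    (hf1 : ∀ k, |f1 k| ≤ B) (hf2 : ∀ k, |f2 k| ≤ B) (hf3 : ∀ k, |f3 k| ≤ B) (hB : 0 ≤ B)
    (aj fj : ι → ℝ)
    (ha : ∀ j ∈ J, |aj j - (a0 + ∑ k, a1 k * r j k
      + 1 / 2 * ∑ z : Fin d × Fin d, a2 z * (r j z.1 * r j z.2))| ≤ (∑ k, |r j k|) ^ 3 * A)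
    (hf : ∀ j ∈ J, |fj j - (∑ k, f1 k * r j k
      + 1 / 2 * ∑ z : Fin d × Fin d, f2 z * (r j z.1 * r j z.2)
      + 1 / 6 * ∑ z : Fin d × Fin d × Fin d, f3 z * (r j z.1 * (r j z.2.1 * r j z.2.2)))|
        ≤ (∑ k, |r j k|) ^ 4 * B) :
    |∑ j ∈ J, v j * ((a0 + aj j) * fj j) - (a0 * ∑ k, f2 (k, k) + ∑ k, a1 k * f1 k)|
      ≤ (2 * d + 2 * d ^ 2 + 2 * d ^ 3 + 22 * d ^ 7) * h ^ 2 * A * B := by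
  have hA : 0 ≤ A := (abs_nonneg _).trans ha0
  have hd1 : (1 : ℝ) ≤ d := by exact_mod_cast hd
  set E : ι → ℝ := fun j => (a0 + aj j) * fj j
    - (∑ k, (2 * a0 * f1 k) * r j k)
    - (∑ z : Fin d × Fin d, (a0 * f2 z + a1 z.1 * f1 z.2) * (r j z.1 * r j z.2))
    - (∑ z : Fin d × Fin d × Fin d, (1 / 3 * a0 * f3 z + 1 / 2 * (a1 z.1 * f2 z.2)
        + 1 / 2 * (a2 (z.1, z.2.1) * f1 z.2.2)) * (r j z.1 * (r j z.2.1 * r j z.2.2))) with hE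
  have AB : ∀ {p q : ℝ}, |p| ≤ A → |q| ≤ B → |p * q| ≤ A * B := by
    intro p q hp hq
    rw [abs_mul]; exact mul_le_mul hp hq (abs_nonneg _) hA
  have s1 := moment (ε := h ^ 2) (Q := 2 * (A * B)) J v (fun j k => r j k) (fun _ => 0)
    (fun k => 2 * a0 * f1 k)
    (by intro k; rw [mul_assoc, abs_mul, abs_two]; linarith [AB ha0 (hf1 k)])
    (by intro k; simpa using m1 k)
  have s2 := moment (ε := h ^ 2) (Q := 2 * (A * B)) J v
    (fun j (z : Fin d × Fin d) => r j z.1 * r j z.2) (fun z => if z.1 = z.2 then 1 else 0)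
    (fun z => a0 * f2 z + a1 z.1 * f1 z.2)
    (by
      intro z
      have := (abs_add_le (a0 * f2 z) (a1 z.1 * f1 z.2)).trans
        (add_le_add (AB ha0 (hf2 z)) (AB (ha1 z.1) (hf1 z.2)))
      linarith)
    (by intro z; exact m2 z.1 z.2)
  have s3 := moment (ε := h ^ 2) (Q := 2 * (A * B)) J v
    (fun j (z : Fin d × Fin d × Fin d) => r j z.1 * (r j z.2.1 * r j z.2.2)) (fun _ => 0)
    (fun z => 1 / 3 * a0 * f3 z + 1 / 2 * (a1 z.1 * f2 z.2)
        + 1 / 2 * (a2 (z.1, z.2.1) * f1 z.2.2))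
    (by
      intro z
      have b1 := abs_le.mp (AB ha0 (hf3 z))
      have b2 := abs_le.mp (AB (ha1 z.1) (hf2 z.2))
      have b3 := abs_le.mp (AB (ha2 (z.1, z.2.1)) (hf1 z.2.2))
      have b0 : 0 ≤ A * B := mul_nonneg hA hB
      rw [abs_le]; constructor <;> nlinarith)
    (by intro z; simpa using m3 z.1 z.2.1 z.2.2)
  simp only [mul_zero, Finset.sum_const_zero, sub_zero, Fintype.card_prod, Fintype.card_fin]
    at s1 s2 s3
  have hdiag : ∑ z : Fin d × Fin d, (a0 * f2 z + a1 z.1 * f1 z.2) * (if z.1 = z.2 then 1 else 0)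
      = a0 * ∑ k, f2 (k, k) + ∑ k, a1 k * f1 k := by
    rw [Fintype.sum_prod_type]
    simp [Finset.mul_sum, Finset.sum_add_distrib]
  rw [hdiag] at s2
  -- second moment
  have hsq : ∑ j ∈ J, v j * ∑ k, (r j k) ^ 2 ≤ 2 * d := by
    simp only [Finset.mul_sum]
    rw [Finset.sum_comm]
    have : ∀ k ∈ (Finset.univ : Finset (Fin d)), ∑ j ∈ J, v j * (r j k) ^ 2 ≤ 2 := by
      intro k _
      have := (abs_le.mp (m2 k k)).2
      simp only [if_true, ← sq] at this
      nlinarith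
    refine (Finset.sum_le_card_nsmul _ _ _ this).trans ?_
    simp [mul_comm]
  have herr : ∀ j ∈ J, |v j * E j| ≤ v j * (∑ k, (r j k) ^ 2) * (d ^ 3 * h ^ 2 * (11 * d ^ 3 * A * B)) := by
    intro j hj
    by_cases hvj : v j = 0
    · simp [hvj]
    have hr := hsupp j hj hvj
    have hsn : 0 ≤ ∑ k, |r j k| := Finset.sum_nonneg (fun _ _ => abs_nonneg _)
    have hs : ∑ k, |r j k| ≤ d * h := by
      refine (Finset.sum_le_card_nsmul _ _ _ (fun k _ => hr k)).trans ?_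
      simp
    have hsd : ∑ k, |r j k| ≤ d := hs.trans (by nlinarith)
    have hcs : (∑ k, |r j k|) ^ 2 ≤ d * ∑ k, (r j k) ^ 2 := by
      have := sq_sum_le_card_mul_sum_sq (s := (Finset.univ : Finset (Fin d)))
        (f := fun k => |r j k|)
      simpa using this
    have hEj : |E j| ≤ (∑ k, |r j k|) ^ 4 * (11 * d ^ 3 * A * B) := by
      have q1 := form_bound a1 (fun k => r j k) ha1
      have q2 := form_bound a2 (fun z => r j z.1 * r j z.2) ha2
      have q3 := form_bound f1 (fun k => r j k) hf1
      have q4 := form_bound f2 (fun z => r j z.1 * r j z.2) hf2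
      have q5 := form_bound f3 (fun z => r j z.1 * (r j z.2.1 * r j z.2.2)) hf3
      rw [abs_sum2] at q2 q4
      rw [abs_sum3] at q5
      have := scalar_err hsn hsd hd1 ha0 q1 q2 q3 q4 q5 hB (ha j hj) (hf j hj)
      refine le_of_eq_of_le ?_ this
      congr 1
      have c1 : (∑ k, (2 * a0 * f1 k) * r j k) = 2 * a0 * ∑ k, f1 k * r j k := by
        rw [Finset.mul_sum]; apply Finset.sum_congr rfl; intro k _; ring
      have c2 : (∑ z : Fin d × Fin d, (a0 * f2 z + a1 z.1 * f1 z.2) * (r j z.1 * r j z.2))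
          = a0 * ∑ z : Fin d × Fin d, f2 z * (r j z.1 * r j z.2)
            + (∑ k, a1 k * r j k) * ∑ k, f1 k * r j k := by
        rw [Finset.mul_sum, Finset.sum_mul_sum, ← Fintype.sum_prod_type', ← Finset.sum_add_distrib]
        apply Finset.sum_congr rfl; intro k _; ring
      have c3 : (∑ z : Fin d × Fin d × Fin d, (1 / 3 * a0 * f3 z + 1 / 2 * (a1 z.1 * f2 z.2)
        + 1 / 2 * (a2 (z.1, z.2.1) * f1 z.2.2)) * (r j z.1 * (r j z.2.1 * r j z.2.2)))
          = 1 / 3 * a0 * ∑ z : Fin d × Fin d × Fin d, f3 z * (r j z.1 * (r j z.2.1 * r j z.2.2))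
            + 1 / 2 * ((∑ k, a1 k * r j k) * ∑ z : Fin d × Fin d, f2 z * (r j z.1 * r j z.2))
            + 1 / 2 * ((∑ z : Fin d × Fin d, a2 z * (r j z.1 * r j z.2)) * ∑ k, f1 k * r j k) := by
        have w : (∑ z : Fin d × Fin d, a2 z * (r j z.1 * r j z.2)) * ∑ k, f1 k * r j k
            = ∑ z : Fin d × Fin d × Fin d, a2 (z.1, z.2.1) * (r j z.1 * r j z.2.1)
              * (f1 z.2.2 * r j z.2.2) := by
          rw [Finset.sum_mul_sum, Fintype.sum_prod_type, Fintype.sum_prod_type]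
          apply Finset.sum_congr rfl; intro k _
          rw [Fintype.sum_prod_type]
        rw [w, Finset.mul_sum, Finset.sum_mul_sum, ← Fintype.sum_prod_type', Finset.mul_sum,
          Finset.mul_sum, ← Finset.sum_add_distrib, ← Finset.sum_add_distrib]
        apply Finset.sum_congr rfl; intro k _; ring
      rw [hE]
      simp only []
      rw [c1, c2, c3]
    rw [abs_mul, abs_of_nonneg (hv j hj), mul_assoc]
    apply mul_le_mul_of_nonneg_left _ (hv j hj)
    refine hEj.trans ?_
    rw [← mul_assoc (∑ k, (r j k) ^ 2)]
    apply mul_le_mul_of_nonneg_right _ (by positivity)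
    have u1 : (∑ k, |r j k|) ^ 2 ≤ (d * h) ^ 2 := pow_le_pow_left₀ hsn hs 2
    calc (∑ k, |r j k|) ^ 4 = (∑ k, |r j k|) ^ 2 * (∑ k, |r j k|) ^ 2 := by ring
      _ ≤ (d * ∑ k, (r j k) ^ 2) * (d * h) ^ 2 := by gcongr
      _ = _ := by ring
  have s4 : |∑ j ∈ J, v j * E j| ≤ (2 * d) * (d ^ 3 * h ^ 2 * (11 * d ^ 3 * A * B)) := by
    refine (Finset.abs_sum_le_sum_abs _ _).trans ((Finset.sum_le_sum herr).trans ?_)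
    rw [← Finset.sum_mul]
    exact mul_le_mul_of_nonneg_right hsq (by positivity)
  have hsplit : ∑ j ∈ J, v j * ((a0 + aj j) * fj j)
      = ∑ j ∈ J, v j * ∑ k, (2 * a0 * f1 k) * r j k
      + ∑ j ∈ J, v j * ∑ z : Fin d × Fin d, (a0 * f2 z + a1 z.1 * f1 z.2) * (r j z.1 * r j z.2)
      + ∑ j ∈ J, v j * ∑ z : Fin d × Fin d × Fin d, (1 / 3 * a0 * f3 z + 1 / 2 * (a1 z.1 * f2 z.2)
        + 1 / 2 * (a2 (z.1, z.2.1) * f1 z.2.2)) * (r j z.1 * (r j z.2.1 * r j z.2.2))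
      + ∑ j ∈ J, v j * E j := by
    rw [← Finset.sum_add_distrib, ← Finset.sum_add_distrib, ← Finset.sum_add_distrib]
    apply Finset.sum_congr rfl; intro j _
    rw [hE]; ring
  rw [hsplit]
  push_cast at s1 s2 s3
  rw [abs_le] at *
  constructor <;> nlinarith

lemma derivP_zero {P : ℝ → ℝ} (hP : ContDiff ℝ 1 P) (hPsupp : ∀ R : ℝ, 1 ≤ R → P R = 0)
    {R : ℝ} (hR : 1 ≤ R) : deriv P R = 0 := by
  have hd : DifferentiableAt ℝ P R := (hP.differentiable (by norm_num)) R
  rw [← hd.derivWithin (uniqueDiffOn_Ici R R Set.self_mem_Ici)]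
  have hc : Set.EqOn P (fun _ => (0:ℝ)) (Set.Ici R) := fun y hy => hPsupp y (hR.trans hy)
  rw [derivWithin_congr hc (hPsupp R hR)]
  simp

lemma mpow_single {d : ℕ} (v : Ed d) (k : Fin d) : mpow v (Pi.single k 1) = v k := by
  unfold mpow
  rw [Finset.prod_eq_single k]
  · simp
  · intro b _ hb; simp [Pi.single_eq_of_ne hb]
  · simp

lemma mpow_zero {d : ℕ} (v : Ed d) : mpow v 0 = 1 := by simp [mpow]

lemma mpow_add {d : ℕ} (v : Ed d) (α β : Fin d → ℕ) :
    mpow v (α + β) = mpow v α * mpow v β := by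
  simp [mpow, pow_add, Finset.prod_mul_distrib]

lemma deg_single {d : ℕ} (k : Fin d) : deg (Pi.single k 1 : Fin d → ℕ) = 1 := by
  simp [deg]

lemma deg_add {d : ℕ} (α β : Fin d → ℕ) : deg (α + β) = deg α + deg β := by
  simp [deg, Finset.sum_add_distrib]

/-- radial weight -/
def wrad (d : ℕ) (σ h : ℝ) (P : ℝ → ℝ) (z : Ed d) : ℝ :=
  -((σ / h ^ (d + 1)) * deriv P (‖z‖ / h) / ‖z‖)

lemma wrad_nonneg {d : ℕ} {σ h : ℝ} (hσ : 0 < σ) (hh : 0 < h) {P : ℝ → ℝ}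
    (hdec : ∀ R : ℝ, 0 ≤ R → deriv P R ≤ 0) (z : Ed d) : 0 ≤ wrad d σ h P z := by
  unfold wrad
  have h1 := hdec (‖z‖ / h) (by positivity)
  have h2 : 0 ≤ σ / h ^ (d + 1) := by positivity
  rw [neg_nonneg]
  exact div_nonpos_of_nonpos_of_nonneg (mul_nonpos_of_nonneg_of_nonpos h2 h1) (norm_nonneg _)

lemma gradW_eq (d : ℕ) (σ h : ℝ) (P : ℝ → ℝ) (p q : Ed d) (k : Fin d) :
    (gradW d σ h P (p - q)) k = wrad d σ h P (p - q) * (q - p) k := by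
  simp only [gradW, wrad, PiLp.smul_apply, PiLp.sub_apply, smul_eq_mul]
  ring

lemma cSPH_eq {d N : ℕ} (σ h : ℝ) (P : ℝ → ℝ) {x : Fin N → Ed d} (hx : Function.Injective x)
    (a : Fin N → ℝ) (V : Fin N → Fin N → ℝ) {i j : Fin N} (hij : j ≠ i) :
    cSPH d N σ h P x a V i j = V i j * wrad d σ h P (x i - x j) * (a i + a j) := by
  have hz : x i - x j ≠ 0 := sub_ne_zero.mpr (fun e => hij (hx e).symm)
  have hn : ‖x i - x j‖ ≠ 0 := norm_ne_zero_iff.mpr hz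
  unfold cSPH gradW wrad
  rw [inner_smul_right, real_inner_self_eq_norm_sq, mul_div_assoc _ (‖x i - x j‖ ^ 2),
    div_self (pow_ne_zero 2 hn)]
  ring

lemma consistency {d : ℕ} (hd : 1 ≤ d) {σ : ℝ} (hσ : 0 < σ)
    {P : ℝ → ℝ} (hP : ContDiff ℝ 1 P)
    (hPsupp : ∀ R : ℝ, 1 ≤ R → P R = 0)
    (hdec : ∀ R : ℝ, 0 ≤ R → deriv P R ≤ 0)
    {l h : ℝ} (hh : 0 < h) (hh1 : h ≤ 1) {N : ℕ} {x : Fin N → Ed d}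
    (hx : Function.Injective x) (hxc : ∀ i, x i ∈ cube d l) (V : Fin N → Fin N → ℝ) (i : Fin N)
    (hV : ∀ j, j ≠ i → 0 ≤ V i j) {a u : Ed d → ℝ} (ha : ContDiff ℝ 3 a) (hu : ContDiff ℝ 4 u)
    (hreg : ∀ α : Fin d → ℕ, deg α ≤ 2 → ∀ β : Fin d → ℕ, deg β = 1 →
            |∑ j ∈ Finset.univ.erase i,
                V i j * mpow (x j - x i) α * mpow (gradW d σ h P (x i - x j)) β
              - (if α = β then (1 : ℝ) else 0)| ≤ h ^ 2) :
    |Lh d N σ h P x (fun i => a (x i)) V (fun j => u (x j)) i - ellip a u (x i)|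
      ≤ (2 * d + 2 * d ^ 2 + 2 * d ^ 3 + 22 * d ^ 7) * h ^ 2 * Cnorm 3 a (cube d l)
        * Cnorm 4 u (cube d l) := by
  have ha' : ContDiff ℝ (3 : ℕ) a := by exact_mod_cast ha
  have hu' : ContDiff ℝ (4 : ℕ) u := by exact_mod_cast hu
  have hp := hxc i
  have key := trunc hd (Finset.univ.erase i) (fun j => V i j * wrad d σ h P (x i - x j))
    (fun j k => (x j - x i) k) hh hh1
    (fun j hj => mul_nonneg (hV j (Finset.ne_of_mem_erase hj)) (wrad_nonneg hσ hh hdec _))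
    (by
      intro j _ hne k
      have hw : wrad d σ h P (x i - x j) ≠ 0 := right_ne_zero_of_mul hne
      have hlt : ‖x i - x j‖ / h < 1 := by
        by_contra hcon
        exact hw (by simp [wrad, derivP_zero hP hPsupp (not_lt.mp hcon)])
      rw [div_lt_one hh] at hlt
      have := PiLp.norm_apply_le (x j - x i) k
      rw [norm_sub_rev, Real.norm_eq_abs] at this
      exact this.trans hlt.le)
    (by
      intro k
      have := hreg 0 (by simp [deg]) (Pi.single k 1) (deg_single k)
      rw [if_neg (by intro e; have := congrArg deg e; rw [deg_single] at this; simp [deg] at this),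
        sub_zero] at this
      simp only [mpow_zero, mpow_single, gradW_eq] at this
      refine le_of_eq_of_le (congrArg abs (Finset.sum_congr rfl fun j _ => ?_)) this
      ring)
    (by
      intro k m
      have := hreg (Pi.single k 1) (by rw [deg_single]; norm_num) (Pi.single m 1) (deg_single m)
      simp only [mpow_single, gradW_eq] at this
      have e : ((Pi.single k 1 : Fin d → ℕ) = Pi.single m 1) ↔ k = m := by
        constructor
        · intro e
          by_contra hkm
          have := congrFun e k
          simp [Pi.single_eq_of_ne hkm] at this
        · rintro rfl; rfl
      simp only [e] at this
      refine le_of_eq_of_le (congrArg abs ?_) this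
      congr 1
      refine Finset.sum_congr rfl fun j _ => ?_
      ring)
    (by
      intro k m n
      have := hreg (Pi.single k 1 + Pi.single m 1) (by rw [deg_add, deg_single, deg_single])
        (Pi.single n 1) (deg_single n)
      rw [if_neg (by
        intro e; have := congrArg deg e; rw [deg_add, deg_single, deg_single, deg_single] at this
        norm_num at this), sub_zero] at this
      simp only [mpow_add, mpow_single, gradW_eq] at this
      refine le_of_eq_of_le (congrArg abs (Finset.sum_congr rfl fun j _ => ?_)) this
      ring)
    (A := Cnorm 3 a (cube d l)) (B := Cnorm 4 u (cube d l)) (a0 := a (x i))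
    (fun k => pd k a (x i)) (fun k => pd k u (x i))
    (fun z => pdl [z.2, z.1] a (x i)) (fun z => pdl [z.2, z.1] u (x i))
    (fun z => pdl [z.2.2, z.2.1, z.1] u (x i))
    (pdl_le_Cnorm ha' [] (by simp) hp) (fun k => pdl_le_Cnorm ha' [k] (by simp) hp)
    (fun z => pdl_le_Cnorm ha' _ (by simp) hp)
    (fun k => pdl_le_Cnorm hu' [k] (by simp) hp)
    (fun z => pdl_le_Cnorm hu' _ (by simp) hp)
    (fun z => pdl_le_Cnorm hu' _ (by simp) hp)
    ((abs_nonneg _).trans (pdl_le_Cnorm hu' [] (by simp) hp))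
    (fun j => a (x j)) (fun j => u (x j) - u (x i))
    (fun j _ => taylor3 hp (hxc j) ha')
    (fun j _ => taylor4 hp (hxc j) hu')
  refine le_of_eq_of_le (congrArg abs ?_) key
  have e1 : Lh d N σ h P x (fun i => a (x i)) V (fun j => u (x j)) i
      = ∑ j ∈ Finset.univ.erase i, V i j * wrad d σ h P (x i - x j)
        * ((a (x i) + a (x j)) * (u (x j) - u (x i))) := by
    unfold Lh
    refine Finset.sum_congr rfl fun j hj => ?_
    rw [cSPH_eq σ h P hx _ V (Finset.ne_of_mem_erase hj)]
    ring
  rw [e1]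
  rfl

lemma pd_exp {d : ℕ} (k k0 : Fin d) (lam c : ℝ) :
    pd k (fun y : Ed d => c * Real.exp (lam * y k0))
      = fun y => (if k = k0 then c * lam else 0) * Real.exp (lam * y k0) := by
  funext y
  unfold pd
  have hl : HasFDerivAt (fun y : Ed d => y k0) (EuclideanSpace.proj k0 : Ed d →L[ℝ] ℝ) y :=
    (EuclideanSpace.proj k0 : Ed d →L[ℝ] ℝ).hasFDerivAt
  have h1 := ((hl.const_mul lam).exp).const_mul c
  rw [h1.fderiv]
  by_cases hk : k = k0
  · subst hk; simp; ring
  · simp [hk, Pi.single_apply, Ne.symm hk]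

lemma ellip_exp {d : ℕ} (k0 : Fin d) (lam : ℝ) (a : Ed d → ℝ) (y : Ed d) :
    ellip a (fun y : Ed d => Real.exp (lam * y k0)) y
      = (a y * lam ^ 2 + pd k0 a y * lam) * Real.exp (lam * y k0) := by
  have h0 : (fun y : Ed d => Real.exp (lam * y k0)) = fun y => 1 * Real.exp (lam * y k0) := by
    simp
  unfold ellip lapl
  rw [h0]
  simp only [pd_exp]
  rw [Finset.sum_eq_single k0, Finset.sum_eq_single k0]
  · simp; ring
  · intro k _ hk; simp [hk]
  · simp
  · intro k _ hk; simp [hk]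
  · simp

lemma Lh_comb {d N : ℕ} (σ h : ℝ) (P : ℝ → ℝ) (x : Fin N → Ed d)
    (a : Fin N → ℝ) (V : Fin N → Fin N → ℝ) (U u g : Fin N → ℝ) (s T K : ℝ) (i : Fin N) :
    Lh d N σ h P x a V (fun j => s * (U j - u j) + T * g j - K) i
      = s * (Lh d N σ h P x a V U i - Lh d N σ h P x a V u i) + T * Lh d N σ h P x a V g i := by
  unfold Lh
  rw [← Finset.sum_sub_distrib, Finset.mul_sum, Finset.mul_sum, ← Finset.sum_add_distrib]
  refine Finset.sum_congr rfl fun j _ => ?_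
  ring

/-- Global error estimate for the variable-coefficient Poisson
equation: second-order convergence in the maximum norm of the VRSPH scheme. -/
theorem stmt_11
    (d : ℕ) (hd : d = 1 ∨ d = 2 ∨ d = 3) (hd0 : 0 < d) (σ : ℝ) (hσ : 0 < σ)
    (P : ℝ → ℝ) (hP : ContDiff ℝ 1 P)
    (hPnn : ∀ R : ℝ, 0 ≤ R → 0 ≤ P R)
    (hPsupp : ∀ R : ℝ, 1 ≤ R → P R = 0)
    (hdec : ∀ R : ℝ, 0 ≤ R → deriv P R ≤ 0) :
    ∃ C > 0, ∀ (l : ℝ), 0 < l → ∀ (h : ℝ), 0 < h → h ≤ 1 →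
      ∀ (N Nin : ℕ) (x : Fin N → Ed d),
        Function.Injective x →
        (∀ i, x i ∈ cube d l) →
        (∀ i : Fin N, (i : ℕ) < Nin → x i ∈ interior (cube d l)) →
        (∀ i : Fin N, Nin ≤ (i : ℕ) → x i ∈ frontier (cube d l)) →
      ∀ (V : Fin N → Fin N → ℝ),
        (∀ i j : Fin N, (i : ℕ) < Nin → j ≠ i → 0 ≤ V i j) →
      ∀ (a : Ed d → ℝ) (amin : ℝ), ContDiff ℝ 3 a → 0 < amin →
        (∀ y ∈ cube d l, amin ≤ a y) →
        ConnBd Nin (cSPH d N σ h P x (fun i => a (x i)) V) →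
      ∀ (u f : Ed d → ℝ), ContDiff ℝ 4 u →
        (∀ y ∈ cube d l, ellip a u y = f y) →
        (∀ y ∈ frontier (cube d l), u y = 0) →
        (∀ i : Fin N, (i : ℕ) < Nin →
          ∀ α : Fin d → ℕ, deg α ≤ 2 → ∀ β : Fin d → ℕ, deg β = 1 →
            |∑ j ∈ Finset.univ.erase i,
                V i j * mpow (x j - x i) α * mpow (gradW d σ h P (x i - x j)) β
              - (if α = β then (1 : ℝ) else 0)| ≤ h ^ 2) →
        C * h ^ 2 * Cnorm 3 a (cube d l) *
            Cnorm 4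
              (fun y => Real.exp
                (((Cnorm 1 a (cube d l) + 2) / amin) * y ⟨0, hd0⟩))
              (cube d l) ≤ 1 →
      ∀ U : Fin N → ℝ,
        (∀ i : Fin N, (i : ℕ) < Nin →
          Lh d N σ h P x (fun i => a (x i)) V U i = f (x i)) →
        (∀ i : Fin N, Nin ≤ (i : ℕ) → U i = 0) →
        ∀ i : Fin N, |U i - u (x i)| ≤
          C * h ^ 2 * Real.exp (((Cnorm 1 a (cube d l) + 2) / amin) * l) *
            Cnorm 3 a (cube d l) * Cnorm 4 u (cube d l) := by
  have hd1 : 1 ≤ d := hd0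
  have hdR : (1 : ℝ) ≤ d := by exact_mod_cast hd1
  refine ⟨2 * d + 2 * d ^ 2 + 2 * d ^ 3 + 22 * d ^ 7, by positivity, ?_⟩
  intro l hl h hh hh1 N Nin x hx hxc hxin hxbd V hV a amin ha hamin haa hconn u f hu hell hubd
    hreg hsmall U hLU hUbd
  set C : ℝ := 2 * d + 2 * d ^ 2 + 2 * d ^ 3 + 22 * d ^ 7 with hC
  have hCpos : 0 < C := by positivity
  set lam : ℝ := (Cnorm 1 a (cube d l) + 2) / amin with hlam
  set g : Ed d → ℝ := fun y => Real.exp (lam * y ⟨0, hd0⟩) with hg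
  intro i
  have ha1 : ContDiff ℝ (1 : ℕ) a := ha.of_le (by norm_num)
  have ha3 : ContDiff ℝ (3 : ℕ) a := by exact_mod_cast ha
  have hu4 : ContDiff ℝ (4 : ℕ) u := by exact_mod_cast hu
  have hgC : ContDiff ℝ 4 g := by
    apply ContDiff.exp
    apply contDiff_const.mul
    exact (EuclideanSpace.proj (⟨0, hd0⟩ : Fin d) : Ed d →L[ℝ] ℝ).contDiff
  have hA1 : ∀ y ∈ cube d l, |a y| ≤ Cnorm 1 a (cube d l) := fun y hy =>
    pdl_le_Cnorm ha1 [] (by simp) hy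
  have hA0 : 0 ≤ Cnorm 1 a (cube d l) := (abs_nonneg _).trans (hA1 _ (hxc i))
  have hA3 : 0 ≤ Cnorm 3 a (cube d l) :=
    (abs_nonneg _).trans (pdl_le_Cnorm ha3 [] (by simp) (hxc i))
  have hU4 : 0 ≤ Cnorm 4 u (cube d l) :=
    (abs_nonneg _).trans (pdl_le_Cnorm hu4 [] (by simp) (hxc i))
  have hlamA : lam * amin = Cnorm 1 a (cube d l) + 2 := by
    rw [hlam]; field_simp
  have hlam1 : 1 ≤ lam := by
    rw [hlam, le_div_iff₀ hamin, one_mul]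
    have := haa _ (hxc i)
    have := (le_abs_self _).trans (hA1 _ (hxc i))
    linarith
  have hLg : ∀ j : Fin N, (j : ℕ) < Nin →
      1 ≤ Lh d N σ h P x (fun i => a (x i)) V (fun j => g (x j)) j := by
    intro j hj
    have hcon := consistency hd1 hσ hP hPsupp hdec hh hh1 hx hxc V j (fun k hk => hV j k hj hk)
      ha hgC (hreg j hj)
    have h2 : 2 ≤ ellip a g (x j) := by
      rw [hg, ellip_exp]
      have e1 : 1 ≤ Real.exp (lam * (x j) ⟨0, hd0⟩) := by
        apply Real.one_le_exp
        exact mul_nonneg (by linarith) (hxc j _).1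
      have e2 := (abs_le.mp (pdl_le_Cnorm ha1 [⟨0, hd0⟩] (by simp) (hxc j))).1
      have e2' : -Cnorm 1 a (cube d l) ≤ pd ⟨0, hd0⟩ a (x j) := e2
      have e3 : Cnorm 1 a (cube d l) + 2 ≤ a (x j) * lam := by
        rw [← hlamA, mul_comm]
        exact mul_le_mul_of_nonneg_right (haa _ (hxc j)) (by linarith)
      have e4 : 2 ≤ a (x j) * lam ^ 2 + pd ⟨0, hd0⟩ a (x j) * lam := by nlinarith
      nlinarith
    have := (abs_le.mp (hcon.trans hsmall)).1
    linarith
  set T : ℝ := C * h ^ 2 * Cnorm 3 a (cube d l) * Cnorm 4 u (cube d l) with hT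
  have hT0 : 0 ≤ T := by positivity
  have hLe : ∀ j : Fin N, (j : ℕ) < Nin →
      |Lh d N σ h P x (fun i => a (x i)) V U j
        - Lh d N σ h P x (fun i => a (x i)) V (fun j => u (x j)) j| ≤ T := by
    intro j hj
    have hcon := consistency hd1 hσ hP hPsupp hdec hh hh1 hx hxc V j (fun k hk => hV j k hj hk)
      ha hu (hreg j hj)
    rw [hLU j hj, ← hell _ (hxc j), abs_sub_comm]
    exact hcon
  have hcnn : ∀ i j : Fin N, (i : ℕ) < Nin → j ≠ i →
      0 ≤ cSPH d N σ h P x (fun i => a (x i)) V i j := by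
    intro i j hi hij
    rw [cSPH_eq σ h P hx _ V hij]
    have b1 := haa _ (hxc i)
    have b2 := haa _ (hxc j)
    exact mul_nonneg (mul_nonneg (hV i j hi hij) (wrad_nonneg hσ hh hdec _))
      (by linarith)
  have main : ∀ s : ℝ, |s| ≤ 1 → s * (U i - u (x i)) ≤ T * Real.exp (lam * l) := by
    intro s hs
    have hmp := max_principle hcnn hconn
      (fun j => s * (U j - u (x j)) + T * g (x j) - T * Real.exp (lam * l))
      (by
        intro j hj
        have e := Lh_comb σ h P x (fun i => a (x i)) V U (fun j => u (x j)) (fun j => g (x j))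
          s T (T * Real.exp (lam * l)) j
        refine le_of_le_of_eq ?_ e.symm
        have k1 := hLg j hj
        have gen : ∀ X : ℝ, |X| ≤ T → |s * X| ≤ T := by
          intro X k2
          rw [abs_mul]
          calc |s| * |X| ≤ 1 * T := mul_le_mul hs k2 (abs_nonneg _) zero_le_one
            _ = T := one_mul _
        have k3 := gen _ (hLe j hj)
        have k4 := (abs_le.mp k3).1
        have k5 := mul_le_mul_of_nonneg_left k1 hT0
        linarith)
      (by
        intro j hj
        rw [hUbd j hj, hubd _ (hxbd j hj)]
        have : g (x j) ≤ Real.exp (lam * l) := by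
          apply Real.exp_le_exp.mpr
          exact mul_le_mul_of_nonneg_left (hxc j _).2 (by linarith)
        have := mul_le_mul_of_nonneg_left this hT0
        linarith)
      i
    have hgp : 0 ≤ T * g (x i) := mul_nonneg hT0 (Real.exp_pos _).le
    linarith
  have f1 := main 1 (by simp)
  have f2 := main (-1) (by simp)
  have : C * h ^ 2 * Real.exp (lam * l) * Cnorm 3 a (cube d l) * Cnorm 4 u (cube d l)
      = T * Real.exp (lam * l) := by rw [hT]; ring
  rw [this, abs_le]
  constructor <;> linarith
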